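/- arXiv:2509.10061 — 7 statements merged into one kernel-verified Lean document; each statement's English description precedes it below -/
import Mathlib

section
/- Let S, X, Y be finite nonempty sets, p a joint probability mass function on S × X whose X-marginal p_X is everywhere positive, d_o : X × Y → [0,∞), and d_p a nonnegative function on pairs of probability distributions on S. Identify each conditional distribution p_{Y|X} with a stochastic matrix W in the compact set Δ = { W ∈ ℝ^{X×Y} : W(y|x) ≥ 0, Σ_y W(y|x) = 1 for all x }. For y ∈ Y let S_y = { W ∈ Δ : Σ_x W(y|x) p_X(x) = 0 }. Assume: (i) d_p(μ, ·) is continuous on the simplex of distributions on S for every fixed first argument μ; and (ii) for every y ∈ Y and every q ∈ S_y, lim_{W → q, W ∉ S_y} Σ_{x∈X} W(y|x) p_X(x) d_p(p_{S|x}, p_{S|y}^W) = 0, where p_{S|x}(s) = p(s,x)/p_X(x) and p_{S|y}^W(s) = (Σ_x W(y|x) p(s,x)) / (Σ_x W(y|x) p_X(x)). Then the information semantic rate distortion function R^I(D_p, D_o) = inf { I(W) : W ∈ Δ, E_p(W) ≤ D_p, E_o(W) ≤ D_o }, where I(W) = Σ_{x,y} p_X(x) W(y|x) log( W(y|x) /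 Σ_{x'} p_X(x') W(y|x') ), E_o(W) = Σ_{x,y} p_X(x) W(y|x) d_o(x,y), and E_p(W) = Σ_x Σ_{y : W ∉ S_y} p_X(x) W(y|x) d_p(p_{S|x}, p_{S|y}^W), is lower semicontinuous as a function on [0,∞) × [0,∞). -/
open Finset

open scoped Pointwise in
/-- The upper closure of a compact set in an ordered topological group is closed. -/
theorem IsCompact.isClosed_upperClosure {α : Type*} [AddCommGroup α] [PartialOrder α]
    [IsOrderedAddMonoid α] [TopologicalSpace α] [IsTopologicalAddGroup α] [ClosedIciTopology α]
    {s : Set α} (hs : IsCompact s) : IsClosed (upperClosure s : Set α) := by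
  rw [← add_zero s, ← add_upperClosure, ← Set.singleton_zero, upperClosure_singleton,
    UpperSet.coe_Ici]
  exact isClosed_Ici.add_left_of_isCompact hs

/-- The value function of a constrained minimisation problem with continuous objective and
continuous constraint map on a compact set is lower semicontinuous in the constraint level. -/
theorem lowerSemicontinuous_sInf_of_isCompact {E : Type*} [TopologicalSpace E] {K : Set E}
    (hK : IsCompact K) {F : E → ℝ × ℝ} (hF : ContinuousOn F K)
    {I : E → ℝ} (hI : ContinuousOn I K) :
    LowerSemicontinuous fun D : ℝ × ℝ =>
      sInf {r : EReal | ∃ W ∈ K, F W ≤ D ∧ r = ((I W : ℝ) : EReal)} := by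
  intro D c hc
  obtain ⟨b, hcb, hb⟩ := EReal.exists_rat_btwn_of_lt hc
  have hA : IsCompact (K ∩ I ⁻¹' Set.Iic ((b : ℚ) : ℝ)) := by
    obtain ⟨u, hu, hu'⟩ := continuousOn_iff_isClosed.1 hI (Set.Iic ((b : ℚ) : ℝ)) isClosed_Iic
    rw [Set.inter_comm, hu', Set.inter_comm]
    exact hK.inter_right hu
  have hU : IsClosed (upperClosure (F '' (K ∩ I ⁻¹' Set.Iic ((b : ℚ) : ℝ))) : Set (ℝ × ℝ)) :=
    IsCompact.isClosed_upperClosure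
      (hA.image_of_continuousOn (hF.mono Set.inter_subset_left))
  have hD : D ∈ (upperClosure (F '' (K ∩ I ⁻¹' Set.Iic ((b : ℚ) : ℝ))) : Set (ℝ × ℝ))ᶜ := by
    rintro ⟨_, ⟨W, ⟨hWK, hWb⟩, rfl⟩, hWD⟩
    refine (hb.trans_le (sInf_le ⟨W, hWK, hWD, rfl⟩)).not_ge ?_
    exact_mod_cast hWb
  filter_upwards [hU.isOpen_compl.mem_nhds hD] with D' hD'
  refine hcb.trans_le (le_sInf ?_)
  rintro _ ⟨W, hWK, hWD, rfl⟩
  by_contra hlt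
  refine hD' ⟨F W, ⟨W, ⟨hWK, ?_⟩, rfl⟩, hWD⟩
  exact_mod_cast (not_le.1 hlt).le

/-- The set of stochastic matrices with rows indexed by `X` and columns by `Y`. -/
def stochasticMatrices (X Y : Type*) [Fintype Y] : Set (X → Y → ℝ) :=
  {W | (∀ x y, 0 ≤ W x y) ∧ ∀ x, ∑ y, W x y = 1}

theorem isCompact_stochasticMatrices (X Y : Type*) [Fintype Y] :
    IsCompact (stochasticMatrices X Y) := by
  have h : stochasticMatrices X Y = Set.univ.pi fun _ : X => stdSimplex ℝ Y := by
    ext W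
    simp [stochasticMatrices, stdSimplex, forall_and]
  rw [h]
  exact isCompact_univ_pi fun _ => isCompact_stdSimplex ℝ Y

/-- The mutual information between the input and the output of a channel with positive input
distribution is continuous in the channel. -/
theorem continuousOn_mutualInformation {X Y : Type*} [Fintype X] [Fintype Y]
    {w : X → ℝ} (hw : ∀ x, 0 < w x) :
    ContinuousOn (fun W : X → Y → ℝ =>
      ∑ x, ∑ y, w x * W x y * Real.log (W x y / ∑ x', w x' * W x' y))
      (stochasticMatrices X Y) := by
  have hcont : Continuous fun W : X → Y → ℝ => ∑ y, (∑ x, w x * (W x y * Real.log (W x y)) -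
      (∑ x, w x * W x y) * Real.log (∑ x, w x * W x y)) := by
    refine continuous_finsetSum _ fun y _ => Continuous.sub ?_ ?_
    · refine continuous_finsetSum _ fun x _ => continuous_const.mul ?_
      exact Real.continuous_mul_log.comp (by fun_prop : Continuous fun W : X → Y → ℝ => W x y)
    · exact Real.continuous_mul_log.comp
        (by fun_prop : Continuous fun W : X → Y → ℝ => ∑ x, w x * W x y)
  refine hcont.continuousOn.congr fun W hW => ?_
  dsimp only
  rw [sum_comm]
  refine sum_congr rfl fun y _ => ?_
  rw [sum_mul, ← sum_sub_distrib]
  refine sum_congr rfl fun x _ => ?_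
  rcases (hW.1 x y).eq_or_lt with h0 | h0
  · simp [← h0]
  · have hpos : 0 < ∑ x', w x' * W x' y :=
      sum_pos' (fun x' _ => mul_nonneg (hw x').le (hW.1 x' y))
        ⟨x, mem_univ x, mul_pos (hw x) h0⟩
    rw [Real.log_div h0.ne' hpos.ne']
    ring

/-- The normalised mixture of the columns `p · x` with nonnegative weights is a probability
distribution, provided the total mass is positive. -/
theorem posterior_mem_simplex {S X : Type*} [Fintype S] [Fintype X]
    {p : S → X → ℝ} (hp : ∀ s x, 0 ≤ p s x) {w : X → ℝ} (hw : ∀ x, w x = ∑ s, p s x)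
    {v : X → ℝ} (hv : ∀ x, 0 ≤ v x) (hpos : 0 < ∑ x, w x * v x) :
    (fun s => (∑ x, v x * p s x) / ∑ x, w x * v x) ∈
      {ν : S → ℝ | (∀ s, 0 ≤ ν s) ∧ ∑ s, ν s = 1} := by
  refine ⟨fun s => div_nonneg (sum_nonneg fun x _ => mul_nonneg (hv x) (hp s x)) hpos.le, ?_⟩
  rw [← sum_div, div_eq_one_iff_eq hpos.ne', sum_comm]
  refine sum_congr rfl fun x _ => ?_
  rw [← mul_sum, hw, mul_comm]

/-- The expected semantic distortion is continuous in the channel if each distortion `d x` is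
continuous on the simplex and the contribution of each output symbol vanishes as its probability
tends to zero. -/
theorem continuousOn_semanticDistortion {S X Y : Type*} [Fintype S] [Fintype X] [Fintype Y]
    {p : S → X → ℝ} (hp : ∀ s x, 0 ≤ p s x) {w : X → ℝ} (hw : ∀ x, w x = ∑ s, p s x)
    {d : X → (S → ℝ) → ℝ}
    (hd : ∀ x, ContinuousOn (d x) {ν : S → ℝ | (∀ s, 0 ≤ ν s) ∧ ∑ s, ν s = 1})
    (hlim : ∀ y : Y, ∀ q ∈ stochasticMatrices X Y, (∑ x, w x * q x y) = 0 →
      Filter.Tendsto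
        (fun W : X → Y → ℝ => ∑ x, w x * W x y *
          d x (fun s => (∑ x', W x' y * p s x') / ∑ x', w x' * W x' y))
        (nhdsWithin q (stochasticMatrices X Y ∩ {W | (∑ x, w x * W x y) ≠ 0})) (nhds 0)) :
    ContinuousOn (fun W : X → Y → ℝ =>
      ∑ x, ∑ y, (if 0 < ∑ x', w x' * W x' y then
        w x * W x y * d x (fun s => (∑ x', W x' y * p s x') / ∑ x', w x' * W x' y) else 0))
      (stochasticMatrices X Y) := by
  have hw0 : ∀ x, 0 ≤ w x := fun x => hw x ▸ sum_nonneg fun s _ => hp s x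
  have hmass : ∀ y, Continuous fun W : X → Y → ℝ => ∑ x, w x * W x y := fun y => by fun_prop
  simp_rw [fun W : X → Y → ℝ => sum_comm (s := (univ : Finset X)) (t := (univ : Finset Y))
    (f := fun x y => if 0 < ∑ x', w x' * W x' y then
      w x * W x y * d x (fun s => (∑ x', W x' y * p s x') / ∑ x', w x' * W x' y) else 0)]
  refine continuousOn_finsetSum _ fun y _ q hq => ?_
  have hq0 : 0 ≤ ∑ x, w x * q x y := sum_nonneg fun x _ => mul_nonneg (hw0 x) (hq.1 x y)
  rcases hq0.eq_or_lt with h0 | hpos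
  · have hval : ∀ W : X → Y → ℝ, (∑ x, w x * W x y) = 0 →
        (∑ x, if 0 < ∑ x', w x' * W x' y then
          w x * W x y * d x (fun s => (∑ x', W x' y * p s x') / ∑ x', w x' * W x' y)
          else 0) = 0 := fun W hW => by simp [hW]
    rw [ContinuousWithinAt, hval q h0.symm,
      ← Set.inter_union_compl (stochasticMatrices X Y) {W | (∑ x, w x * W x y) ≠ 0},
      nhdsWithin_union]
    refine Filter.Tendsto.sup ?_ ?_
    · refine (hlim y q hq h0.symm).congr' ?_
      filter_upwards [self_mem_nhdsWithin] with W hW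
      have hWpos : 0 < ∑ x, w x * W x y :=
        (sum_nonneg fun x _ => mul_nonneg (hw0 x) (hW.1.1 x y)).lt_of_ne' hW.2
      simp [hWpos]
    · refine tendsto_const_nhds.congr' ?_
      filter_upwards [self_mem_nhdsWithin] with W hW
      exact (hval W (not_not.1 hW.2)).symm
  · have hev : ∀ᶠ W in nhdsWithin q (stochasticMatrices X Y), 0 < ∑ x, w x * W x y :=
      nhdsWithin_le_nhds ((hmass y).continuousAt.eventually_const_lt hpos)
    refine tendsto_finsetSum _ fun x _ => ?_
    rw [if_pos hpos]
    have hpost : ContinuousAt (fun (W : X → Y → ℝ) (s : S) =>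
        (∑ x', W x' y * p s x') / ∑ x', w x' * W x' y) q :=
      continuousAt_pi.2 fun s => ContinuousAt.div
        (by fun_prop : Continuous fun W : X → Y → ℝ => ∑ x', W x' y * p s x').continuousAt
        (hmass y).continuousAt hpos.ne'
    have hdist : Filter.Tendsto (fun W : X → Y → ℝ =>
        d x (fun s => (∑ x', W x' y * p s x') / ∑ x', w x' * W x' y))
        (nhdsWithin q (stochasticMatrices X Y))
        (nhds (d x (fun s => (∑ x', q x' y * p s x') / ∑ x', w x' * q x' y))) := by
      refine (hd x _ (posterior_mem_simplex hp hw (fun x' => hq.1 x' y) hpos)).tendsto.comp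
        (tendsto_nhdsWithin_iff.2 ⟨hpost.tendsto.mono_left nhdsWithin_le_nhds, ?_⟩)
      filter_upwards [hev, self_mem_nhdsWithin] with W hW hWK
      exact posterior_mem_simplex hp hw (fun x' => hWK.1 x' y) hW
    have hcoef : Filter.Tendsto (fun W : X → Y → ℝ => w x * W x y)
        (nhdsWithin q (stochasticMatrices X Y)) (nhds (w x * q x y)) :=
      (by fun_prop : Continuous fun W : X → Y → ℝ => w x * W x y).continuousWithinAt
    refine (hcoef.mul hdist).congr' ?_
    filter_upwards [hev] with W hW
    rw [if_pos hW]

/-- Under the regularity conditions of Proposition 2, the information semantic rate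
distortion function `R^I(D_p, D_o)` is lower semicontinuous on `[0,∞) × [0,∞)`. -/
theorem semantic_rate_distortion_lowerSemicontinuous
    {S X Y : Type*} [Fintype S] [Fintype X] [Fintype Y]
    [Nonempty S] [Nonempty X] [Nonempty Y]
    (p : S → X → ℝ) (hp_nonneg : ∀ s x, 0 ≤ p s x) (hp_sum : ∑ s, ∑ x, p s x = 1)
    (pX : X → ℝ) (hpX : ∀ x, pX x = ∑ s, p s x) (hpX_pos : ∀ x, 0 < pX x)
    (dO : X → Y → ℝ) (hdO : ∀ x y, 0 ≤ dO x y)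
    (dP : (S → ℝ) → (S → ℝ) → ℝ)
    (hdP : ∀ μ ν : S → ℝ, ((∀ s, 0 ≤ μ s) ∧ ∑ s, μ s = 1) →
      ((∀ s, 0 ≤ ν s) ∧ ∑ s, ν s = 1) → 0 ≤ dP μ ν)
    -- (i) `d_p(μ, ·)` is continuous on the simplex of distributions on `S`
    (hdP_cont : ∀ μ : S → ℝ,
      ContinuousOn (dP μ) {ν : S → ℝ | (∀ s, 0 ≤ ν s) ∧ ∑ s, ν s = 1})
    -- (ii) the regularity condition (18): for every `y` and every `q ∈ S_y`,
    -- the partial expected semantic distortion tends to `0` as `W → q`, `W ∉ S_y`.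
    (hlim : ∀ y : Y, ∀ q : X → Y → ℝ,
      (∀ x y', 0 ≤ q x y') → (∀ x, ∑ y', q x y' = 1) →
      (∑ x, pX x * q x y) = 0 →
      Filter.Tendsto
        (fun W : X → Y → ℝ => ∑ x, W x y * pX x *
          dP (fun s => p s x / pX x)
             (fun s => (∑ x', W x' y * p s x') / ∑ x', pX x' * W x' y))
        (nhdsWithin q {W : X → Y → ℝ | (∀ x y', 0 ≤ W x y') ∧
            (∀ x, ∑ y', W x y' = 1) ∧ (∑ x, pX x * W x y) ≠ 0})
        (nhds 0))
    (RI : ℝ → ℝ → EReal)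
    (hRI : ∀ Dp Do_ : ℝ, RI Dp Do_ = sInf {r : EReal |
      ∃ W : X → Y → ℝ,
        (∀ x y, 0 ≤ W x y) ∧ (∀ x, ∑ y, W x y = 1) ∧
        (∑ x, ∑ y, (if 0 < ∑ x', pX x' * W x' y then
            pX x * W x y * dP (fun s => p s x / pX x)
              (fun s => (∑ x', W x' y * p s x') / ∑ x', pX x' * W x' y)
          else 0)) ≤ Dp ∧
        (∑ x, ∑ y, pX x * W x y * dO x y) ≤ Do_ ∧
        r = ((∑ x, ∑ y, pX x * W x y *
              Real.log (W x y / ∑ x', pX x' * W x' y) : ℝ) : EReal)}) :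
    LowerSemicontinuousOn (fun D : ℝ × ℝ => RI D.1 D.2)
      (Set.Ici (0 : ℝ) ×ˢ Set.Ici (0 : ℝ)) := by
  have hEp := continuousOn_semanticDistortion (Y := Y) hp_nonneg hpX
    (d := fun x => dP (fun s => p s x / pX x)) (fun x => hdP_cont _) (fun y q hq h0 => by
      have h := hlim y q hq.1 hq.2 h0
      simp_rw [mul_comm _ (pX _)] at h
      exact h.mono_left (nhdsWithin_mono _ fun W hW => ⟨hW.1.1, hW.1.2, hW.2⟩))
  have hEo : Continuous fun W : X → Y → ℝ => ∑ x, ∑ y, pX x * W x y * dO x y := by fun_prop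
  have hmain := lowerSemicontinuous_sInf_of_isCompact (isCompact_stochasticMatrices X Y)
    (hEp.prodMk hEo.continuousOn) (continuousOn_mutualInformation (Y := Y) hpX_pos)
  refine LowerSemicontinuous.lowerSemicontinuousOn ?_ _
  convert hmain using 2 with D
  rw [hRI]
  simp only [stochasticMatrices, Set.mem_ofPred_eq, Prod.le_def, and_assoc]
end

section
/- Fix q ∈ [0,1] with q ≠ 1/2 and set C = |1 − 2q|. Define, for w, z ∈ [0,1]: I(w,z) = h₂((w+z)/2) − (h₂(w) + h₂(z))/2, Γ(w,z) = (1 + z − w)/2, and Λ(w,z) = C·( wz/(w+z) + (1−w)(1−z)/(2−w−z) ), where any fraction with zero denominator is taken to be 0. For D_o ∈ [0,1] let a(D_o) = 2C·D_o(1−D_o) if 0 ≤ D_o ≤ 1/2 and a(D_o) = C/2 if 1/2 < D_o ≤ 1, and define R(D_p, D_o) = inf { I(w,z) : w, z ∈ [0,1], Λ(w,z) ≤ D_p, Γ(w,z) ≤ D_o }. Then for every D_o ∈ [0,1] and every D_p ∈ [0, a(D_o)], R(D_p, D_o) = 1 − h₂( (1 − √(1 − 2D_p/C))/2 ). -/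
/-- Binary entropy function with base-2 logarithm (with `h₂ 0 = h₂ 1 = 0` by the
Lean convention `logb 2 0 = 0`). -/
noncomputable def binEnt (x : ℝ) : ℝ :=
  -(x * Real.logb 2 x) - (1 - x) * Real.logb 2 (1 - x)

/-- Mutual information `I(w,z)` of the binary test channel `[[w,1−w],[z,1−z]]`
with uniform input. -/
noncomputable def mutI (w z : ℝ) : ℝ :=
  binEnt ((w + z) / 2) - (binEnt w + binEnt z) / 2

/-- Expected total-variation semantic distortion `Λ(w,z)` (fractions with zero
denominator are `0` by the Lean convention `a / 0 = 0`). -/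
noncomputable def lamTV (C w z : ℝ) : ℝ :=
  C * (w * z / (w + z) + (1 - w) * (1 - z) / (2 - w - z))

/-- Expected Hamming distortion `Γ(w,z)`. -/
noncomputable def gamH (w z : ℝ) : ℝ := (1 + z - w) / 2

/-- The threshold `a(D_o)`. -/
noncomputable def aThresh (C Do_ : ℝ) : ℝ :=
  if Do_ ≤ 1 / 2 then 2 * C * Do_ * (1 - Do_) else C / 2

/-- The semantic rate distortion function `R(D_p, D_o)` for the binary case. -/
noncomputable def Rbin (C Dp Do_ : ℝ) : ℝ :=
  sInf {r : ℝ | ∃ w z : ℝ, w ∈ Set.Icc (0 : ℝ) 1 ∧ z ∈ Set.Icc (0 : ℝ) 1 ∧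
    lamTV C w z ≤ Dp ∧ gamH w z ≤ Do_ ∧ r = mutI w z}

open Real Set in
/-- The base-2 entropy is the natural one divided by `log 2`. -/
theorem binEnt_eq_binEntropy_div (x : ℝ) : binEnt x = binEntropy x / log 2 := by
  rw [binEnt, binEntropy_eq_negMulLog_add_negMulLog_one_sub, negMulLog, negMulLog, logb, logb]
  ring

open Real Set in
theorem monotoneOn_log_one_add_sub_log_one_sub_div :
    MonotoneOn (fun s : ℝ => (log (1 + s) - log (1 - s)) / s) (Ioo 0 1) := by
  have key : ∀ s ∈ Ioo (0 : ℝ) 1, HasSum (fun k : ℕ => 2 * (1 / (2 * k + 1)) * s ^ (2 * k))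
      ((log (1 + s) - log (1 - s)) / s) := by
    intro s hs
    have h := (hasSum_log_sub_log_of_abs_lt_one (abs_lt.2 ⟨by linarith [hs.1], hs.2⟩)).div_const s
    refine h.congr_fun ?_
    intro k
    have := hs.1.ne'
    field_simp
    ring
  intro s hs t ht hst
  refine hasSum_le (fun k => ?_) (key s hs) (key t ht)
  have := pow_le_pow_left₀ hs.1.le hst (2 * k)
  gcongr

open Real Set in
theorem hasDerivAt_binEntropy_sqrt {t : ℝ} (ht : t ∈ Ioo (0 : ℝ) 1) :
    HasDerivAt (fun t => binEntropy ((1 - √t) / 2))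
      (-((log (1 + √t) - log (1 - √t)) / √t) / 4) t := by
  have hs : 0 < √t := sqrt_pos.2 ht.1
  have hs1 : √t < 1 := (sqrt_lt' one_pos).2 (by simpa using ht.2)
  have h1 : HasDerivAt (fun t => (1 - √t) / 2) (-(1 / (2 * √t)) / 2) t :=
    ((hasDerivAt_sqrt ht.1.ne').const_sub 1).div_const 2
  have h2 := (hasDerivAt_binEntropy (p := (1 - √t) / 2) (by linarith) (by linarith)).comp t h1
  refine h2.congr_deriv ?_
  rw [show 1 - (1 - √t) / 2 = (1 + √t) / 2 by ring,
    log_div (by linarith) two_ne_zero, log_div (by linarith) two_ne_zero]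
  field_simp
  ring

open Real Set in
theorem concaveOn_binEntropy_sqrt :
    ConcaveOn ℝ (Icc 0 1) (fun t => binEntropy ((1 - √t) / 2)) := by
  refine AntitoneOn.concaveOn_of_deriv (convex_Icc 0 1) ?_ ?_ ?_
  · exact (binEntropy_continuous.comp (by fun_prop)).continuousOn
  · rw [interior_Icc]
    exact fun t ht => (hasDerivAt_binEntropy_sqrt ht).differentiableAt.differentiableWithinAt
  · rw [interior_Icc]
    have hmem : ∀ t ∈ Ioo (0 : ℝ) 1, √t ∈ Ioo (0 : ℝ) 1 := fun t ht =>
      ⟨sqrt_pos.2 ht.1, (sqrt_lt' one_pos).2 (by simpa using ht.2)⟩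
    intro s hs t ht hst
    rw [(hasDerivAt_binEntropy_sqrt hs).deriv, (hasDerivAt_binEntropy_sqrt ht).deriv]
    have := monotoneOn_log_one_add_sub_log_one_sub_div (hmem s hs) (hmem t ht) (sqrt_le_sqrt hst)
    simp only at this
    linarith

open Real Set in
theorem antitoneOn_binEntropy_sqrt :
    AntitoneOn (fun t => binEntropy ((1 - √t) / 2)) (Icc 0 1) := by
  have hmem : ∀ t ∈ Icc (0 : ℝ) 1, (1 - √t) / 2 ∈ Icc (0 : ℝ) 2⁻¹ := by
    intro t ht
    have h1 : √t ≤ 1 := sqrt_le_one.2 ht.2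
    have h0 := sqrt_nonneg t
    constructor <;> linarith
  intro s hs t ht hst
  refine binEntropy_strictMonoOn.monotoneOn (hmem t ht) (hmem s hs) ?_
  have := sqrt_le_sqrt hst
  linarith

open Real in
theorem binEntropy_sqrt_sq (x : ℝ) : binEntropy ((1 - √((1 - 2 * x) ^ 2)) / 2) = binEntropy x := by
  rw [sqrt_sq_eq_abs]
  rcases abs_cases (1 - 2 * x) with ⟨h, -⟩ | ⟨h, -⟩ <;> rw [h]
  · congr 1; ring
  · rw [← binEntropy_one_sub]; congr 1; ring

open Real in
/-- Grouping property of the entropy for one row of the joint distribution. -/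
theorem half_add_mul_binEntropy_div {a b : ℝ} (ha : 0 ≤ a) (hb : 0 ≤ b) :
    (a + b) / 2 * binEntropy (a / (a + b)) =
      (negMulLog a + negMulLog b) / 2 + (a + b) / 2 * log 2 - negMulLog ((a + b) / 2) := by
  rcases (add_nonneg ha hb).eq_or_lt' with h | h
  · obtain rfl : a = 0 := by linarith
    obtain rfl : b = 0 := by linarith
    simp
  · have hb' : 1 - a / (a + b) = b / (a + b) := by field_simp; ring
    have key : ∀ c : ℝ, (a + b) / 2 * negMulLog (c / (a + b)) =
        (negMulLog c + c * log (a + b)) / 2 := by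
      intro c
      rw [div_eq_mul_inv c, negMulLog_mul, negMulLog, negMulLog, log_inv]
      field_simp
    rw [binEntropy_eq_negMulLog_add_negMulLog_one_sub, hb', mul_add, key, key,
      negMulLog.eq_def ((a + b) / 2), log_div h.ne' two_ne_zero]
    ring

open Real in
theorem half_add_mul_sq_one_sub_two_mul_div (a b : ℝ) :
    (a + b) / 2 * (1 - 2 * (a / (a + b))) ^ 2 = (a + b) / 2 - 2 * (a * b / (a + b)) := by
  by_cases h : a + b = 0
  · simp [h]
  · field_simp
    ring

theorem sq_one_sub_two_mul_div_mem_Icc {a b : ℝ} (ha : 0 ≤ a) (hb : 0 ≤ b) :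
    (1 - 2 * (a / (a + b))) ^ 2 ∈ Set.Icc (0 : ℝ) 1 := by
  have h0 : 0 ≤ a / (a + b) := by positivity
  have h1 : a / (a + b) ≤ 1 := div_le_one_of_le₀ (by linarith) (by positivity)
  exact ⟨sq_nonneg _, by nlinarith⟩

open Real Set in
/-- The converse: the mutual information is bounded below in terms of the semantic distortion. -/
theorem one_sub_binEnt_le_mutI {w z d : ℝ} (hw : w ∈ Icc (0 : ℝ) 1) (hz : z ∈ Icc (0 : ℝ) 1)
    (hd : d ≤ 1 / 2) (h : w * z / (w + z) + (1 - w) * (1 - z) / (2 - w - z) ≤ d) :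
    1 - binEnt ((1 - √(1 - 2 * d)) / 2) ≤ mutI w z := by
  have hw' : 0 ≤ 1 - w := by linarith [hw.2]
  have hz' : 0 ≤ 1 - z := by linarith [hz.2]
  have e2 : 1 - w + (1 - z) = 2 - w - z := by ring
  have t1 := sq_one_sub_two_mul_div_mem_Icc hw.1 hz.1
  have t2 := sq_one_sub_two_mul_div_mem_Icc hw' hz'
  have v1 := half_add_mul_sq_one_sub_two_mul_div w z
  have v2 := half_add_mul_sq_one_sub_two_mul_div (1 - w) (1 - z)
  have g1 := half_add_mul_binEntropy_div hw.1 hz.1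
  have g2 := half_add_mul_binEntropy_div hw' hz'
  have hp : 0 ≤ (w + z) / 2 := by linarith [hw.1, hz.1]
  have hp' : 0 ≤ (1 - w + (1 - z)) / 2 := by linarith
  have hsum : (w + z) / 2 + (1 - w + (1 - z)) / 2 = 1 := by ring
  have jensen := concaveOn_binEntropy_sqrt.2 t1 t2 hp hp' hsum
  have hm := concaveOn_binEntropy_sqrt.1 t1 t2 hp hp' hsum
  have hd0 : 0 ≤ w * z / (w + z) + (1 - w) * (1 - z) / (2 - w - z) :=
    add_nonneg (div_nonneg (mul_nonneg hw.1 hz.1) (by linarith))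
      (div_nonneg (mul_nonneg hw' hz') (by linarith))
  simp only [smul_eq_mul, binEntropy_sqrt_sq] at jensen hm
  rw [e2] at v2
  have hle := antitoneOn_binEntropy_sqrt (a := 1 - 2 * d) ⟨by linarith, by linarith⟩ hm
    (by rw [e2, v1, v2]; linarith)
  have hH : binEntropy ((w + z) / 2) =
      negMulLog ((w + z) / 2) + negMulLog ((1 - w + (1 - z)) / 2) := by
    rw [binEntropy_eq_negMulLog_add_negMulLog_one_sub]
    congr 2; ring
  have hl : 0 < log 2 := log_pos one_lt_two
  simp only [mutI, binEnt_eq_binEntropy_div]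
  rw [show ∀ x y u l : ℝ, x / l - (y / l + u / l) / 2 = (x - (y + u) / 2) / l by intros; ring,
    le_div_iff₀ hl, sub_mul, div_mul_cancel₀ _ hl.ne', hH,
    binEntropy_eq_negMulLog_add_negMulLog_one_sub w,
    binEntropy_eq_negMulLog_add_negMulLog_one_sub z]
  simp only at hle
  linarith

theorem binEnt_one_sub (x : ℝ) : binEnt (1 - x) = binEnt x := by
  simp only [binEnt_eq_binEntropy_div, Real.binEntropy_one_sub]

theorem binEnt_half : binEnt (1 / 2) = 1 := by
  rw [binEnt_eq_binEntropy_div, one_div, Real.binEntropy_two_inv,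
    div_self (Real.log_pos one_lt_two).ne']

/-- Theorem 3, first branch: for `D_p ∈ [0, a(D_o)]` the binary semantic rate
distortion function equals `1 − h₂((1 − √(1 − 2·D_p/C))/2)`. -/
theorem binary_rate_distortion_small_Dp
    (q : ℝ) (hq : q ∈ Set.Icc (0 : ℝ) 1) (hq' : q ≠ 1 / 2)
    (C : ℝ) (hC : C = |1 - 2 * q|)
    (Do_ : ℝ) (hDo : Do_ ∈ Set.Icc (0 : ℝ) 1)
    (Dp : ℝ) (hDp : Dp ∈ Set.Icc (0 : ℝ) (aThresh C Do_)) :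
    Rbin C Dp Do_ = 1 - binEnt ((1 - Real.sqrt (1 - 2 * Dp / C)) / 2) := by
  have hCpos : 0 < C := by
    rw [hC, abs_pos]
    exact fun h => hq' (by linarith)
  obtain ⟨d, rfl⟩ : ∃ d, Dp = C * d := ⟨Dp / C, by field_simp⟩
  have hd0 : 0 ≤ d := nonneg_of_mul_nonneg_right hDp.1 hCpos
  have hdle : d ≤ 1 / 2 ∧ (Do_ ≤ 1 / 2 → d ≤ 2 * Do_ * (1 - Do_)) := by
    have h := hDp.2
    unfold aThresh at h
    split_ifs at h with hc
    · have : d ≤ 2 * Do_ * (1 - Do_) := le_of_mul_le_mul_left (by linarith) hCpos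
      exact ⟨by nlinarith [sq_nonneg (2 * Do_ - 1)], fun _ => this⟩
    · exact ⟨le_of_mul_le_mul_left (by linarith) hCpos, fun h' => absurd h' hc⟩
  rw [show 2 * (C * d) / C = 2 * d by field_simp]
  refine IsLeast.csInf_eq ⟨?_, ?_⟩
  · have hs0 := Real.sqrt_nonneg (1 - 2 * d)
    have hs1 : √(1 - 2 * d) ≤ 1 := Real.sqrt_le_one.2 (by linarith)
    have hsq : √(1 - 2 * d) ^ 2 = 1 - 2 * d := Real.sq_sqrt (by linarith [hdle.1])
    have hDs : 1 - 2 * Do_ ≤ √(1 - 2 * d) := by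
      rcases le_or_gt Do_ (1 / 2) with h | h
      · exact Real.le_sqrt_of_sq_le (by nlinarith [hdle.2 h])
      · linarith
    set s := √(1 - 2 * d)
    refine ⟨(1 + s) / 2, (1 - s) / 2, ⟨by linarith, by linarith⟩, ⟨by linarith, by linarith⟩,
      ?_, ?_, ?_⟩
    · rw [lamTV, show (1 + s) / 2 + (1 - s) / 2 = 1 by ring,
        show 2 - (1 + s) / 2 - (1 - s) / 2 = 1 by ring]
      refine mul_le_mul_of_nonneg_left ?_ hCpos.le
      nlinarith
    · rw [gamH]
      linarith
    · rw [mutI, show (1 + s) / 2 = 1 - (1 - s) / 2 by ring, binEnt_one_sub,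
        show (1 - (1 - s) / 2 + (1 - s) / 2) / 2 = 1 / 2 by ring, binEnt_half]
      ring
  · rintro r ⟨w, z, hw, hz, hl, -, rfl⟩
    exact one_sub_binEnt_le_mutI hw hz hdle.1 (le_of_mul_le_mul_left hl hCpos)
end

section
/- Fix q ∈ [0,1] and set C = |1 − 2q|. Define, for w, z ∈ [0,1]: Γ(w,z) = (1 + z − w)/2 and Λ(w,z) = C·( wz/(w+z) + (1−w)(1−z)/(2−w−z) ), where any fraction with zero denominator is taken to be 0, and for D_o ∈ [0,1] let a(D_o) = 2C·D_o(1−D_o) if 0 ≤ D_o ≤ 1/2 and a(D_o) = C/2 if 1/2 < D_o ≤ 1. Then for every D_o ∈ [0,1] and every D_p with D_p > a(D_o), and for all w, z ∈ [0,1]: if Γ(w,z) ≤ D_o then Λ(w,z) ≤ D_p. -/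
/-- Quadratic upper bound for half the harmonic mean of two nonnegative reals. -/
theorem mul_div_add_le {a b : ℝ} (ha : 0 ≤ a) (hb : 0 ≤ b) :
    a * b / (a + b) ≤ (a + b) / 4 - (a - b) ^ 2 * (2 - a - b) / 4 := by
  rcases (add_nonneg ha hb).eq_or_lt with h | h
  · obtain rfl : a = 0 := by linarith
    obtain rfl : b = 0 := by linarith
    simp
  · rw [div_le_iff₀ h]
    linarith [mul_nonneg (sq_nonneg (a - b)) (sq_nonneg (a + b - 1))]

/-- For `C ≥ 0`, the semantic distortion is at most `2 C Γ (1 - Γ) = C (1 - (w - z)²) / 2`. -/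
theorem lamTV_le {C w z : ℝ} (hC : 0 ≤ C) (hw : w ∈ Set.Icc (0 : ℝ) 1)
    (hz : z ∈ Set.Icc (0 : ℝ) 1) : lamTV C w z ≤ C * ((1 - (w - z) ^ 2) / 2) := by
  refine mul_le_mul_of_nonneg_left ?_ hC
  have h₁ := mul_div_add_le hw.1 hz.1
  have h₂ := mul_div_add_le (sub_nonneg.2 hw.2) (sub_nonneg.2 hz.2)
  rw [show 1 - w + (1 - z) = 2 - w - z by ring] at h₂
  linarith

/-- Proposition 5: if `D_p > a(D_o)`, then the Hamming-distortion constraint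
`Γ(w,z) ≤ D_o` implies the semantic-distortion constraint `Λ(w,z) ≤ D_p`. -/
theorem gamma_le_implies_lambda_le
    (q : ℝ) (hq : q ∈ Set.Icc (0 : ℝ) 1)
    (C : ℝ) (hC : C = |1 - 2 * q|)
    (Do_ : ℝ) (hDo : Do_ ∈ Set.Icc (0 : ℝ) 1)
    (Dp : ℝ) (hDp : aThresh C Do_ < Dp)
    (w z : ℝ) (hw : w ∈ Set.Icc (0 : ℝ) 1) (hz : z ∈ Set.Icc (0 : ℝ) 1)
    (hΓ : gamH w z ≤ Do_) :
    lamTV C w z ≤ Dp := by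
  have hC₀ : 0 ≤ C := hC ▸ abs_nonneg _
  refine (lamTV_le hC₀ hw hz).trans (le_trans ?_ hDp.le)
  unfold gamH at hΓ
  unfold aThresh
  split_ifs with h
  · have hsq : (1 - 2 * Do_) ^ 2 ≤ (w - z) ^ 2 :=
      pow_le_pow_left₀ (by linarith) (by linarith) 2
    linarith [mul_le_mul_of_nonneg_left hsq hC₀]
  · linarith [mul_nonneg hC₀ (sq_nonneg (w - z))]
end

section
/- Fix C > 0 and z ∈ [0,1], and define φ(w) = C·( wz/(w+z) + (1−w)(1−z)/(2−w−z) ) for w ∈ [0,1], with the convention that fractions with zero denominator are 0. Then φ is monotonically decreasing on the interval [z, 1]: for all z ≤ w₁ ≤ w₂ ≤ 1, φ(w₂) ≤ φ(w₁). -/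
/-- The difference of two values of `x ↦ x * b / (x + b)`. -/
lemma mul_div_add_sub_mul_div_add {b x y : ℝ} (hx : x + b ≠ 0) (hy : y + b ≠ 0) :
    y * b / (y + b) - x * b / (x + b) = (y - x) * (b ^ 2 / ((x + b) * (y + b))) := by
  field_simp
  ring

/-- To the right of `b`, the slopes of `x ↦ x * b / (x + b)` are at most `1 / 4`. -/
lemma mul_div_add_sub_le {b x y : ℝ} (hb : 0 ≤ b) (hbx : b ≤ x) (hxy : x ≤ y) :
    y * b / (y + b) - x * b / (x + b) ≤ (y - x) / 4 := by
  rcases hb.eq_or_lt with rfl | hb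
  · simp only [mul_zero, zero_div, sub_zero]
    linarith
  have hx : 0 < x + b := by linarith
  have hy : 0 < y + b := by linarith
  rw [mul_div_add_sub_mul_div_add hx.ne' hy.ne', div_eq_mul_one_div (y - x)]
  refine mul_le_mul_of_nonneg_left ?_ (sub_nonneg.2 hxy)
  rw [div_le_div_iff₀ (by positivity) (by norm_num)]
  nlinarith [mul_le_mul (show 2 * b ≤ x + b by linarith) (show 2 * b ≤ y + b by linarith)
    (by positivity) hx.le]

/-- To the left of `b`, the slopes of `x ↦ x * b / (x + b)` are at least `1 / 4`. -/
lemma le_mul_div_add_sub {b x y : ℝ} (hx₀ : 0 ≤ x) (hxy : x ≤ y) (hyb : y ≤ b) :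
    (y - x) / 4 ≤ y * b / (y + b) - x * b / (x + b) := by
  rcases (hx₀.trans (hxy.trans hyb)).eq_or_lt with rfl | hb
  · simp only [mul_zero, zero_div, sub_zero]
    linarith
  have hx : 0 < x + b := by linarith
  have hy : 0 < y + b := by linarith
  rw [mul_div_add_sub_mul_div_add hx.ne' hy.ne', div_eq_mul_one_div (y - x)]
  refine mul_le_mul_of_nonneg_left ?_ (sub_nonneg.2 hxy)
  rw [div_le_div_iff₀ (by norm_num) (by positivity)]
  nlinarith [mul_le_mul (show x + b ≤ 2 * b by linarith) (show y + b ≤ 2 * b by linarith)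
    hy.le (by positivity)]

/-- For fixed `z ∈ [0,1]`, the map `w ↦ Λ(w,z)` is monotonically decreasing on `[z,1]`. -/
theorem lambda_decreasing_in_w
    (C : ℝ) (hC : 0 < C)
    (z : ℝ) (hz : z ∈ Set.Icc (0 : ℝ) 1)
    (w₁ w₂ : ℝ) (h₁ : z ≤ w₁) (h₁₂ : w₁ ≤ w₂) (h₂ : w₂ ≤ 1) :
    lamTV C w₂ z ≤ lamTV C w₁ z := by
  unfold lamTV
  refine mul_le_mul_of_nonneg_left ?_ hC.le
  have hl := mul_div_add_sub_le hz.1 h₁ h₁₂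
  have hr := le_mul_div_add_sub (b := 1 - z) (x := 1 - w₂) (y := 1 - w₁)
    (by linarith) (by linarith) (by linarith)
  rw [show 1 - w₁ + (1 - z) = 2 - w₁ - z by ring,
    show 1 - w₂ + (1 - z) = 2 - w₂ - z by ring] at hr
  linarith
end

section
/- Fix A ∈ [0, 1/2) and C > 0, and for t ∈ [ (1−2A)/(1−A), 1 ] define θ(t) = √( t(2−t)(1−2A) )/2, w(t) = t/2 + θ(t), and z(t) = t/2 − θ(t). Then for every such t one has 0 ≤ z(t) ≤ w(t) ≤ 1 and Λ(w(t), z(t)) = C·A, where Λ(w,z) = C·( wz/(w+z) + (1−w)(1−z)/(2−w−z) ) with the convention that fractions with zero denominator are 0. -/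
/-- The parameterization `θ(t) = √(t(2−t)(1−2A))/2`. -/
noncomputable def thetaA (A t : ℝ) : ℝ := Real.sqrt (t * (2 - t) * (1 - 2 * A)) / 2

/-- The curve `(w(t), z(t)) = (t/2 + θ(t), t/2 − θ(t))`, `t ∈ [(1−2A)/(1−A), 1]`,
lies in the region `0 ≤ z ≤ w ≤ 1` and parameterizes the level set `Λ = C·A`. -/
theorem parameterization_of_level_set
    (A : ℝ) (hA : A ∈ Set.Ico (0 : ℝ) (1 / 2)) (C : ℝ) (hC : 0 < C)
    (t : ℝ) (ht : t ∈ Set.Icc ((1 - 2 * A) / (1 - A)) 1) :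
    0 ≤ t / 2 - thetaA A t ∧
    t / 2 - thetaA A t ≤ t / 2 + thetaA A t ∧
    t / 2 + thetaA A t ≤ 1 ∧
    lamTV C (t / 2 + thetaA A t) (t / 2 - thetaA A t) = C * A := by
  obtain ⟨hA0, hA1⟩ := hA
  obtain ⟨ht0, ht1⟩ := ht
  have hts : 1 - 2 * A ≤ t * (1 - A) := (div_le_iff₀ (by linarith)).1 ht0
  have htpos : 0 < t := lt_of_lt_of_le (div_pos (by linarith) (by linarith)) ht0
  have hθ0 : 0 ≤ thetaA A t := div_nonneg (Real.sqrt_nonneg _) zero_le_two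
  have hθsq : thetaA A t ^ 2 = t * (2 - t) * (1 - 2 * A) / 4 := by
    have hnonneg : 0 ≤ t * (2 - t) * (1 - 2 * A) :=
      mul_nonneg (mul_nonneg htpos.le (by linarith)) (by linarith)
    rw [thetaA, div_pow, Real.sq_sqrt hnonneg]
    norm_num
  have hθt : thetaA A t ≤ t / 2 := by
    refine (sq_le_sq₀ hθ0 (by linarith)).1 ?_
    rw [hθsq]
    nlinarith [mul_nonneg htpos.le (sub_nonneg.2 hts)]
  refine ⟨by linarith, by linarith, by linarith, ?_⟩
  have hprod : (t / 2 + thetaA A t) * (t / 2 - thetaA A t) =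
      t * ((t - (2 - t) * (1 - 2 * A)) / 4) := by
    linear_combination -hθsq
  have hcoprod : (1 - (t / 2 + thetaA A t)) * (1 - (t / 2 - thetaA A t)) =
      (2 - t) * ((2 - t - t * (1 - 2 * A)) / 4) := by
    linear_combination -hθsq
  have hsum : t / 2 + thetaA A t + (t / 2 - thetaA A t) = t := by ring
  have hcosum : 2 - (t / 2 + thetaA A t) - (t / 2 - thetaA A t) = 2 - t := by ring
  have hcot : 2 - t ≠ 0 := (by linarith : (0 : ℝ) < 2 - t).ne'
  rw [lamTV, hprod, hcoprod, hsum, hcosum, mul_div_cancel_left₀ _ htpos.ne',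
    mul_div_cancel_left₀ _ hcot]
  ring
end

section
/- Fix q ∈ [0,1] and consider the joint distribution of (S, X) on {0,1}² with P(S=0) = P(S=1) = 1/2 and P(X=s | S=s) = q, P(X≠s | S=s) = 1−q, and let Y be generated from X by the channel P(Y=0|X=0) = w, P(Y=0|X=1) = z for w, z ∈ [0,1] with (S, Y) conditionally independent given X. Then, writing d_TV for the total variation distance between probability distributions on {0,1}, the expected semantic distortion satisfies Σ_{x,y ∈ {0,1}} P(X=x) P(Y=y|X=x) · d_TV( P(S=· | X=x), P(S=· | Y=y) ) = |1−2q| · ( wz/(w+z) + (1−w)(1−z)/(2−w−z) ), where any fraction with zero denominator is 0 and terms with P(Y=y) = 0 are omitted. -/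
open Finset

/-- Posterior gap for a symmetric binary source, where `a` and `b` are the likelihoods of the
observation under the two inputs. -/
lemma abs_sub_symmetric_posterior {a b : ℝ} (p : ℝ) (ha : 0 ≤ a) (hb : 0 ≤ b) (hab : a + b ≠ 0) :
    |p - (a * p + b * (1 - p)) / (a + b)| = |1 - 2 * p| * (b / (a + b)) := by
  have h : p - (a * p + b * (1 - p)) / (a + b) = -((1 - 2 * p) * (b / (a + b))) := by
    field_simp
    ring
  rw [h, abs_neg, abs_mul, abs_of_nonneg (div_nonneg hb (add_nonneg ha hb))]

/-- For the doubly symmetric binary semantic source (uniform `S`, symmetric channel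
`p_{X|S}` with parameter `q`) and the binary test channel `[[w,1−w],[z,1−z]]`
(with `S — X — Y` a Markov chain), the expected total-variation semantic
distortion equals `|1−2q|·(wz/(w+z) + (1−w)(1−z)/(2−w−z))`.
Here `false` encodes `0` and `true` encodes `1`. -/
theorem expected_tv_semantic_distortion_binary
    (q w z : ℝ) (hq : q ∈ Set.Icc (0 : ℝ) 1)
    (hw : w ∈ Set.Icc (0 : ℝ) 1) (hz : z ∈ Set.Icc (0 : ℝ) 1)
    -- joint law of (S, X): P(S=s) = 1/2, P(X=s|S=s) = q
    (pSX : Bool → Bool → ℝ)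
    (hpSX : ∀ s x, pSX s x = (1 / 2) * (if x = s then q else 1 - q))
    -- channel X → Y: P(Y=0|X=0) = w, P(Y=0|X=1) = z
    (W : Bool → Bool → ℝ)
    (hW00 : W false false = w) (hW01 : W false true = 1 - w)
    (hW10 : W true false = z) (hW11 : W true true = 1 - z)
    (pX : Bool → ℝ) (hpX : ∀ x, pX x = ∑ s, pSX s x)
    (pY : Bool → ℝ) (hpY : ∀ y, pY y = ∑ x, pX x * W x y)
    -- posterior of S given X, and of S given Y (via the Markov chain S — X — Y)
    (pS_X : Bool → Bool → ℝ) (hpS_X : ∀ s x, pS_X s x = pSX s x / pX x)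
    (pS_Y : Bool → Bool → ℝ)
    (hpS_Y : ∀ s y, pS_Y s y = (∑ x, W x y * pSX s x) / pY y)
    -- total variation distance on distributions over {0,1}
    (dTV : (Bool → ℝ) → (Bool → ℝ) → ℝ)
    (hdTV : ∀ μ ν, dTV μ ν = (1 / 2) * ∑ s, |μ s - ν s|) :
    (∑ x, ∑ y, if pY y ≠ 0 then
        pX x * W x y * dTV (fun s => pS_X s x) (fun s => pS_Y s y)
      else 0)
      = |1 - 2 * q| * (w * z / (w + z) + (1 - w) * (1 - z) / (2 - w - z)) := by
  have hX : ∀ x, pX x = 1 / 2 := by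
    intro x
    rw [hpX, Fintype.sum_bool, hpSX, hpSX]
    cases x <;> simp <;> ring
  have hY : ∀ y, pY y = (W false y + W true y) / 2 := by
    intro y
    rw [hpY, Fintype.sum_bool, hX, hX]
    ring
  have hSX : ∀ s x, pS_X s x = if x = s then q else 1 - q := by
    intro s x
    rw [hpS_X, hpSX, hX]
    ring
  have hSY : ∀ s y, pS_Y s y =
      (W s y * q + W (!s) y * (1 - q)) / (W s y + W (!s) y) := by
    intro s y
    rw [hpS_Y, Fintype.sum_bool, hpSX, hpSX, hY, ← mul_div_mul_left _ (W s y + W (!s) y)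
      (one_div_ne_zero (two_ne_zero (α := ℝ)))]
    cases s <;> simp <;> congr 1 <;> ring
  have hW : ∀ x y, 0 ≤ W x y := by
    intro x y
    cases x <;> cases y <;> linarith [hw.1, hw.2, hz.1, hz.2]
  have hTV : ∀ x y, pY y ≠ 0 → dTV (fun s => pS_X s x) (fun s => pS_Y s y) =
      |1 - 2 * q| * (W (!x) y / (W x y + W (!x) y)) := by
    intro x y hy
    have hxy : W x y + W (!x) y ≠ 0 := by
      intro h
      apply hy
      rw [hY]
      cases x <;> simp only [Bool.not_false, Bool.not_true] at h <;> linarith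
    have hsame := abs_sub_symmetric_posterior q (hW x y) (hW (!x) y) hxy
    have hflip : 1 - q - (W (!x) y * q + W x y * (1 - q)) / (W (!x) y + W x y) =
        -(q - (W x y * q + W (!x) y * (1 - q)) / (W x y + W (!x) y)) := by
      rw [add_comm (W (!x) y) (W x y)]
      field_simp
      ring
    have hother := (congrArg abs hflip).trans ((abs_neg _).trans hsame)
    rw [hdTV, Fintype.sum_bool]
    simp only [hSX, hSY]
    cases x <;> simp only [Bool.not_false, Bool.not_true, if_true, reduceCtorEq, if_false]
      at hsame hother ⊢ <;> rw [hsame, hother] <;> ring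
  have hsum : ∀ y, (∑ x, if pY y ≠ 0 then
        pX x * W x y * dTV (fun s => pS_X s x) (fun s => pS_Y s y) else 0) =
      |1 - 2 * q| * (W false y * W true y / (W false y + W true y)) := by
    intro y
    by_cases hy : pY y = 0
    · have h0 : W false y + W true y = 0 := by linarith [hY y]
      simp [hy, h0]
    · rw [Fintype.sum_bool, if_pos hy, if_pos hy, hTV _ _ hy, hTV _ _ hy, hX, hX,
        Bool.not_true, Bool.not_false, add_comm (W true y) (W false y)]
      ring
  rw [Finset.sum_comm, Fintype.sum_bool, hsum, hsum, hW00, hW01, hW10, hW11,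
    show 1 - w + (1 - z) = 2 - w - z by ring]
  ring
end

section
/- Let S, X, Y be finite nonempty sets, p a joint probability mass function on S × X whose X-marginal p_X is everywhere positive, and d_p a nonnegative function on pairs of probability distributions on S such that d_p(μ, ·) is continuous on the simplex for each fixed μ. Identify conditional distributions p_{Y|X} with stochastic matrices W in Δ = { W ∈ ℝ^{X×Y} : W(y|x) ≥ 0, Σ_y W(y|x) = 1 for all x }, and for y ∈ Y let S_y = { W ∈ Δ : Σ_x W(y|x) p_X(x) = 0 }. Assume that for every y ∈ Y and every q ∈ S_y, lim_{W → q, W ∉ S_y} Σ_{x∈X} W(y|x) p_X(x) d_p(p_{S|x}, p_{S|y}^W) = 0, where p_{S|x}(s) = p(s,x)/p_X(x) and p_{S|y}^W(s) = (Σ_x W(y|x) p(s,x)) / (Σ_x W(y|x) p_X(x)). Then the map W ↦ E_p(W) = Σ_x Σ_{y : W ∉ S_y} p_X(x) W(y|x) d_p(p_{S|x}, p_{S|y}^W) is continuous on Δ. -/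
open Finset

/-- Under the regularity conditions of Proposition 2 (continuity of `d_p(μ, ·)` on
the simplex, and the vanishing-limit condition at channels with a zero-probability
output), the expected semantic probability distortion `W ↦ E_p(W)` is continuous
on the set `Δ` of stochastic matrices. -/
theorem expected_semantic_distortion_continuous
    {S X Y : Type*} [Fintype S] [Fintype X] [Fintype Y]
    [Nonempty S] [Nonempty X] [Nonempty Y]
    (p : S → X → ℝ) (hp_nonneg : ∀ s x, 0 ≤ p s x) (hp_sum : ∑ s, ∑ x, p s x = 1)
    (pX : X → ℝ) (hpX : ∀ x, pX x = ∑ s, p s x) (hpX_pos : ∀ x, 0 < pX x)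
    (dP : (S → ℝ) → (S → ℝ) → ℝ)
    (hdP : ∀ μ ν : S → ℝ, ((∀ s, 0 ≤ μ s) ∧ ∑ s, μ s = 1) →
      ((∀ s, 0 ≤ ν s) ∧ ∑ s, ν s = 1) → 0 ≤ dP μ ν)
    -- `d_p(μ, ·)` is continuous on the simplex of distributions on `S`
    (hdP_cont : ∀ μ : S → ℝ,
      ContinuousOn (dP μ) {ν : S → ℝ | (∀ s, 0 ≤ ν s) ∧ ∑ s, ν s = 1})
    -- the vanishing-limit regularity condition at every `q ∈ S_y`
    (hlim : ∀ y : Y, ∀ q : X → Y → ℝ,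
      (∀ x y', 0 ≤ q x y') → (∀ x, ∑ y', q x y' = 1) →
      (∑ x, pX x * q x y) = 0 →
      Filter.Tendsto
        (fun W : X → Y → ℝ => ∑ x, W x y * pX x *
          dP (fun s => p s x / pX x)
             (fun s => (∑ x', W x' y * p s x') / ∑ x', pX x' * W x' y))
        (nhdsWithin q {W : X → Y → ℝ | (∀ x y', 0 ≤ W x y') ∧
            (∀ x, ∑ y', W x y' = 1) ∧ (∑ x, pX x * W x y) ≠ 0})
        (nhds 0)) :
    ContinuousOn
      (fun W : X → Y → ℝ => ∑ x, ∑ y,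
        if 0 < ∑ x', pX x' * W x' y then
          pX x * W x y * dP (fun s => p s x / pX x)
            (fun s => (∑ x', W x' y * p s x') / ∑ x', pX x' * W x' y)
        else 0)
      {W : X → Y → ℝ | (∀ x y, 0 ≤ W x y) ∧ ∀ x, ∑ y, W x y = 1} := by
  have hcD : ∀ y : Y, Continuous fun W : X → Y → ℝ => ∑ x', pX x' * W x' y :=
    fun y => by fun_prop
  have hcN : ∀ (y : Y) (s : S), Continuous fun W : X → Y → ℝ => ∑ x', W x' y * p s x' :=
    fun y s => by fun_prop
  simp_rw [Finset.sum_comm (s := (Finset.univ : Finset X)) (t := (Finset.univ : Finset Y)),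
    Finset.sum_ite_irrel, Finset.sum_const_zero]
  refine continuousOn_finsetSum _ fun y _ => ?_
  rintro q ⟨hq0, hq1⟩
  have hDnonneg : 0 ≤ ∑ x', pX x' * q x' y :=
    Finset.sum_nonneg fun x _ => mul_nonneg (hpX_pos x).le (hq0 x y)
  rcases hDnonneg.eq_or_lt with hD | hD
  · unfold ContinuousWithinAt
    beta_reduce
    rw [if_neg hD.symm.le.not_gt]
    refine Filter.Tendsto.if ?_ tendsto_const_nhds
    refine ((hlim y q hq0 hq1 hD.symm).mono_left ?_).congr fun W =>
      Finset.sum_congr rfl fun x _ => by rw [mul_comm (W x y)]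
    rw [← nhdsWithin_inter']
    exact nhdsWithin_mono q fun W hW => ⟨hW.1.1, hW.1.2, ne_of_gt hW.2⟩
  · have hmem : {W : X → Y → ℝ | 0 < ∑ x', pX x' * W x' y} ∈ nhds q :=
      (isOpen_lt continuous_const (hcD y)).mem_nhds hD
    rw [← continuousWithinAt_inter hmem]
    refine ContinuousWithinAt.congr
      (f := fun W : X → Y → ℝ => ∑ x, pX x * W x y * dP (fun s => p s x / pX x)
        (fun s => (∑ x', W x' y * p s x') / ∑ x', pX x' * W x' y))
      ?_ (fun W hW => if_pos hW.2) (if_pos hD)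
    have hpost : Set.MapsTo
        (fun (W : X → Y → ℝ) (s : S) => (∑ x', W x' y * p s x') / ∑ x', pX x' * W x' y)
        ({W : X → Y → ℝ | (∀ x y, 0 ≤ W x y) ∧ ∀ x, ∑ y, W x y = 1} ∩
          {W : X → Y → ℝ | 0 < ∑ x', pX x' * W x' y})
        {ν : S → ℝ | (∀ s, 0 ≤ ν s) ∧ ∑ s, ν s = 1} := by
      rintro W ⟨⟨hW0, -⟩, hWD⟩
      refine ⟨fun s => div_nonneg
        (Finset.sum_nonneg fun x _ => mul_nonneg (hW0 x y) (hp_nonneg s x)) (le_of_lt hWD), ?_⟩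
      rw [← Finset.sum_div, Finset.sum_comm, div_eq_one_iff_eq (ne_of_gt hWD)]
      refine Finset.sum_congr rfl fun x _ => ?_
      rw [← Finset.mul_sum, ← hpX, mul_comm]
    have hcont : ContinuousAt
        (fun (W : X → Y → ℝ) (s : S) => (∑ x', W x' y * p s x') / ∑ x', pX x' * W x' y) q :=
      continuousAt_pi.2 fun s => (hcN y s).continuousAt.div (hcD y).continuousAt hD.ne'
    refine tendsto_finsetSum _ fun x _ => ContinuousWithinAt.mul ?_ ?_
    · exact Continuous.continuousWithinAt (by fun_prop)
    · exact ((hdP_cont (fun s => p s x / pX x)) _ (hpost ⟨⟨hq0, hq1⟩, hD⟩)).comp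
        hcont.continuousWithinAt hpost
end
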